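/- arXiv:1604.07707 — 2 statements merged into one kernel-verified Lean document; each statement's English description precedes it below -/
import Mathlib

section
/- Let d ≥ 1 be an integer and ρ : ℕ* → [0, ∞) a nonincreasing sequence with lim_{n→∞} ρ(n) = 0. Assume there exist C̃ > 0, M > 0 and L₁ ∈ ℕ* such that for all integers L ≥ L₁ and all n ∈ ℕ*: ρ(2n) ≤ 2(2L+1)^d ρ(n)² + 2C̃ e^{−ML}. Then lim_{n→∞} n^d ρ(n) = 0. -/
lemma aux_tail (d : ℕ) (C M η : ℝ) (hC : 0 < C) (hM : 0 < M) (hη : 0 < η) :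
    ∀ᶠ L : ℕ in Filter.atTop, 2 * C * Real.exp (-M * L) * (2 * (L : ℝ) + 3) ^ d ≤ η := by
  have h1 : Filter.Tendsto (fun L : ℕ => M * (L : ℝ)) Filter.atTop Filter.atTop :=
    Filter.Tendsto.const_mul_atTop hM tendsto_natCast_atTop_atTop
  have h2 := ((Real.tendsto_pow_mul_exp_neg_atTop_nhds_zero d).comp h1).const_mul
    (2 * C * (5 / M) ^ d)
  rw [mul_zero] at h2
  filter_upwards [h2.eventually (gt_mem_nhds hη), Filter.eventually_ge_atTop 1] with L hL h1L
  refine le_trans ?_ hL.le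
  have h1L' : (1 : ℝ) ≤ L := by exact_mod_cast h1L
  have : (2 * (L : ℝ) + 3) ^ d ≤ (5 / M) ^ d * (M * L) ^ d := by
    rw [← mul_pow]
    apply pow_le_pow_left₀ (by positivity)
    have : 5 / M * (M * L) = 5 * (L : ℝ) := by field_simp
    rw [this]; linarith
  calc _ ≤ 2 * C * Real.exp (-M * L) * ((5 / M) ^ d * (M * L) ^ d) := by gcongr
    _ = _ := by
      simp only [Function.comp, neg_mul]; ring

lemma aux_choose (d : ℕ) (hd : 1 ≤ d) (C M ε : ℝ) (hC : 0 < C) (hM : 0 < M) (hε : 0 < ε)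
    (L₁ : ℕ) : ∃ δ : ℝ, 0 < δ ∧ ∀ r : ℝ, 0 < r → r ≤ δ → ∃ L : ℕ, L₁ ≤ L ∧
      2 * (2 * (L : ℝ) + 1) ^ d * r ^ 2 + 2 * C * Real.exp (-M * L) ≤ ε * r := by
  obtain ⟨L₂, hL₂⟩ := Filter.eventually_atTop.1
    (aux_tail d C M (ε ^ 2 / 8) hC hM (by positivity))
  set L₃ := max L₁ L₂ with hL₃
  refine ⟨ε / (4 * (2 * (L₃ : ℝ) + 1) ^ d), by positivity, fun r hr hrδ => ?_⟩
  rw [le_div_iff₀ (by positivity)] at hrδ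
  have hex : ∃ L : ℕ, ε < r * (4 * (2 * (L : ℝ) + 1) ^ d) := by
    obtain ⟨L, hL⟩ := exists_nat_gt (ε / r)
    refine ⟨L, ?_⟩
    rw [div_lt_iff₀ hr] at hL
    have : (2 * (L : ℝ) + 1) ≤ (2 * (L : ℝ) + 1) ^ d :=
      le_self_pow₀ (by linarith [Nat.cast_nonneg (α := ℝ) L]) (by omega)
    have h3 : (L : ℝ) ≤ 4 * (2 * (L : ℝ) + 1) ^ d := by
      linarith [Nat.cast_nonneg (α := ℝ) L]
    nlinarith
  classical
  set K := Nat.find hex with hK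
  have hKs : ε < r * (4 * (2 * (K : ℝ) + 1) ^ d) := Nat.find_spec hex
  have hKL : L₃ < K := by
    by_contra hcon
    push Not at hcon
    have : (2 * (K : ℝ) + 1) ^ d ≤ (2 * (L₃ : ℝ) + 1) ^ d := by gcongr
    nlinarith
  obtain ⟨L, hLK⟩ : ∃ L, K = L + 1 := ⟨K - 1, by omega⟩
  have hmin : r * (4 * (2 * (L : ℝ) + 1) ^ d) ≤ ε := by
    have := Nat.find_min hex (m := L) (by omega)
    exact not_lt.1 this
  refine ⟨L, by omega, ?_⟩
  have ht := hL₂ L (by omega)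
  rw [hLK] at hKs
  push_cast at hKs
  have e : 2 * ((L : ℝ) + 1) + 1 = 2 * L + 3 := by ring
  rw [e] at hKs
  have hP : 0 < (2 * (L : ℝ) + 3) ^ d := by positivity
  have h2 : 2 * C * Real.exp (-M * L) ≤ ε / 2 * r := by
    refine le_of_mul_le_mul_right (ht.trans ?_) hP
    nlinarith
  nlinarith


/-- Lemma `DecrescenzaPolinomiale`.  Let `d ≥ 1` and `ρ : ℕ* → [0,∞)`
a nonincreasing sequence with `ρ(n) → 0`.  If there are `C̃ > 0`, `M > 0`, `L₁ ∈ ℕ*`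
such that `ρ(2n) ≤ 2(2L+1)^d ρ(n)² + 2 C̃ e^{-M L}` for all `L ≥ L₁` and all `n ≥ 1`,
then `n^d ρ(n) → 0`. -/
theorem stmt_1 (d : ℕ) (hd : 1 ≤ d) (ρ : ℕ → ℝ)
    (hnonneg : ∀ n : ℕ, 1 ≤ n → 0 ≤ ρ n)
    (hantitone : ∀ m n : ℕ, 1 ≤ m → m ≤ n → ρ n ≤ ρ m)
    (hlim : Filter.Tendsto ρ Filter.atTop (nhds 0))
    (C M : ℝ) (hC : 0 < C) (hM : 0 < M) (L₁ : ℕ) (hL₁ : 1 ≤ L₁)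
    (hrec : ∀ L : ℕ, L₁ ≤ L → ∀ n : ℕ, 1 ≤ n →
      ρ (2 * n) ≤ 2 * (2 * (L : ℝ) + 1) ^ d * ρ n ^ 2 + 2 * C * Real.exp (-M * L)) :
    Filter.Tendsto (fun n : ℕ => (n : ℝ) ^ d * ρ n) Filter.atTop (nhds 0) := by
  set ε : ℝ := 1 / 3 ^ (d + 1) with hεd
  have hε : 0 < ε := by positivity
  obtain ⟨δ, hδ, hch⟩ := aux_choose d hd C M ε hC hM hε L₁
  obtain ⟨N₀, hN₀⟩ := Filter.eventually_atTop.1 (hlim.eventually (gt_mem_nhds hδ))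
  set N := max N₀ 1 with hN
  have step : ∀ n, N ≤ n → ρ (2 * n) ≤ ε * ρ n := by
    intro n hn
    have h1 : 1 ≤ n := by omega
    rcases (hnonneg n h1).eq_or_lt with h0 | h0
    · rw [← h0, mul_zero]
      by_contra hcon
      push Not at hcon
      obtain ⟨L₂, hL₂⟩ := Filter.eventually_atTop.1
        (aux_tail 0 C M (ρ (2 * n) / 2) hC hM (by positivity))
      have a := hL₂ (max L₁ L₂) (le_max_right _ _)
      have b := hrec (max L₁ L₂) (le_max_left _ _) n h1
      rw [← h0] at b
      rw [pow_zero, mul_one] at a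
      have c : (2 : ℝ) * (2 * ((max L₁ L₂ : ℕ) : ℝ) + 1) ^ d * 0 ^ 2 = 0 := by ring
      rw [c] at b
      linarith
    · obtain ⟨L, hL, hle⟩ := hch (ρ n) h0 (hN₀ n (by omega)).le
      exact (hrec L hL n h1).trans hle
  have hρ1 := hnonneg 1 le_rfl
  set K : ℝ := (2 * (N : ℝ)) ^ (d + 1) * ρ 1 with hK
  have bd : ∀ n : ℕ, 1 ≤ n → (n : ℝ) ^ (d + 1) * ρ n ≤ K := by
    intro n
    induction n using Nat.strong_induction_on with
    | _ n ih =>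
      intro h1
      by_cases hlt : n < 2 * N
      · have hc : (n : ℝ) ≤ 2 * (N : ℝ) := by exact_mod_cast hlt.le
        have := hantitone 1 n le_rfl h1
        have := hnonneg n h1
        rw [hK]
        gcongr
      · have hm : N ≤ n / 2 := by omega
        have hm1 : 1 ≤ n / 2 := by omega
        have i := ih (n / 2) (by omega) hm1
        have a := (hantitone (2 * (n / 2)) n (by omega) (by omega)).trans (step _ hm)
        have hc : (n : ℝ) ≤ 3 * ((n / 2 : ℕ) : ℝ) := by
          exact_mod_cast (by omega : n ≤ 3 * (n / 2))
        refine le_trans ?_ i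
        have hnn := hnonneg _ hm1
        calc (n : ℝ) ^ (d + 1) * ρ n
            ≤ (3 * ((n / 2 : ℕ) : ℝ)) ^ (d + 1) * (ε * ρ (n / 2)) := by
              have := hnonneg n h1
              gcongr
          _ = _ := by
              rw [mul_pow, hεd]; field_simp
  refine squeeze_zero' ?_ ?_ (tendsto_const_div_atTop_nhds_zero_nat K)
  · filter_upwards [Filter.eventually_ge_atTop 1] with n hn
    have := hnonneg n hn
    positivity
  · filter_upwards [Filter.eventually_ge_atTop 1] with n hn
    have hn' : (0 : ℝ) < n := by exact_mod_cast hn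
    rw [le_div_iff₀ hn']
    have := bd n hn
    rw [pow_succ] at this
    linarith
end

section
/- Let d ≥ 1 and R ≥ 1 be integers and ρ : ℕ* → [0, ∞) a nonincreasing sequence satisfying ρ(2n) ≤ (2nR+1)^d ρ(n)² for all n ∈ ℕ*, and lim_{n→∞} n^d ρ(n) = 0. Set Ĉ = (2R+1)^d, so that (2nR+1)^d ≤ Ĉ n^d for all n ≥ 1. Then for every n₁ ∈ ℕ* such that 2^d Ĉ n₁^d ρ(n₁) < 1, one has ρ(n) ≤ e^{−λ n} for all n ≥ n₁, where λ = −(1/(2n₁)) log(2^d Ĉ n₁^d ρ(n₁)) > 0. -/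
/-- Lemma `VitesseExplicite`.  Let `d, R ≥ 1` and `ρ : ℕ* → [0,∞)`
nonincreasing with `ρ(2n) ≤ (2nR+1)^d ρ(n)²` for all `n ≥ 1` and `n^d ρ(n) → 0`.
Put `Ĉ = (2R+1)^d`, so `(2nR+1)^d ≤ Ĉ n^d` for `n ≥ 1`.  Then for every `n₁ ≥ 1`
with `2^d Ĉ n₁^d ρ(n₁) < 1` (and `ρ(n₁) > 0`, cf. the reduction to `ρ > 0` in the
paper), setting `λ = -(1/(2n₁)) log(2^d Ĉ n₁^d ρ(n₁))` one has `λ > 0` and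
`ρ(n) ≤ e^{-λ n}` for all `n ≥ n₁`. -/
theorem stmt_2 (d R : ℕ) (hd : 1 ≤ d) (hR : 1 ≤ R) (ρ : ℕ → ℝ)
    (hnonneg : ∀ n : ℕ, 1 ≤ n → 0 ≤ ρ n)
    (hantitone : ∀ m n : ℕ, 1 ≤ m → m ≤ n → ρ n ≤ ρ m)
    (hrec : ∀ n : ℕ, 1 ≤ n → ρ (2 * n) ≤ (2 * (n : ℝ) * R + 1) ^ d * ρ n ^ 2)
    (hlim : Filter.Tendsto (fun n : ℕ => (n : ℝ) ^ d * ρ n) Filter.atTop (nhds 0))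
    (Chat : ℝ) (hChat : Chat = (2 * (R : ℝ) + 1) ^ d)
    (n₁ : ℕ) (hn₁ : 1 ≤ n₁) (hρpos : 0 < ρ n₁)
    (hsmall : 2 ^ d * Chat * (n₁ : ℝ) ^ d * ρ n₁ < 1)
    (lam : ℝ)
    (hlam : lam = -(1 / (2 * (n₁ : ℝ))) * Real.log (2 ^ d * Chat * (n₁ : ℝ) ^ d * ρ n₁)) :
    0 < lam ∧ ∀ n : ℕ, n₁ ≤ n → ρ n ≤ Real.exp (-lam * n) := by
  have hn : (1 : ℝ) ≤ n₁ := by exact_mod_cast hn₁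
  have hC1 : 1 ≤ Chat := by
    rw [hChat]
    apply one_le_pow₀
    have : (0 : ℝ) ≤ R := Nat.cast_nonneg R
    linarith
  have h2d : (1 : ℝ) ≤ 2 ^ d := one_le_pow₀ (by norm_num)
  set a : ℝ := 2 ^ d * Chat * (n₁ : ℝ) ^ d * ρ n₁ with ha
  have ha0 : 0 < a := by positivity
  have hlog : Real.log a < 0 := Real.log_neg ha0 hsmall
  have hkey : ∀ k : ℕ, 2 ^ d * Chat * ((2 ^ k * n₁ : ℕ) : ℝ) ^ d * ρ (2 ^ k * n₁) ≤ a ^ (2 ^ k) := by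
    intro k
    induction k with
    | zero => simp [ha]
    | succ k ih =>
      have hm : 1 ≤ 2 ^ k * n₁ := Nat.mul_pos (by positivity) hn₁
      have e : 2 ^ (k + 1) * n₁ = 2 * (2 ^ k * n₁) := by ring
      rw [e]
      generalize 2 ^ k * n₁ = m at ih hm
      have hm' : (1 : ℝ) ≤ m := by exact_mod_cast hm
      have hr0 := hnonneg m hm
      have h1 : (2 * (m : ℝ) * R + 1) ^ d ≤ Chat * (m : ℝ) ^ d := by
        rw [hChat, ← mul_pow]
        apply pow_le_pow_left₀ (by positivity)
        nlinarith
      have h2 : ρ (2 * m) ≤ Chat * (m : ℝ) ^ d * ρ m ^ 2 :=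
        (hrec m hm).trans (mul_le_mul_of_nonneg_right h1 (by positivity))
      calc 2 ^ d * Chat * ((2 * m : ℕ) : ℝ) ^ d * ρ (2 * m)
          ≤ 2 ^ d * Chat * ((2 * m : ℕ) : ℝ) ^ d * (Chat * (m : ℝ) ^ d * ρ m ^ 2) :=
            mul_le_mul_of_nonneg_left h2 (by positivity)
        _ = (2 ^ d * Chat * (m : ℝ) ^ d * ρ m) ^ 2 := by
            push_cast
            rw [mul_pow 2 (m : ℝ) d]
            ring
        _ ≤ (a ^ (2 ^ k)) ^ 2 := pow_le_pow_left₀ (by positivity) ih 2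
        _ = a ^ (2 ^ (k + 1)) := by rw [← pow_mul, pow_succ]
  refine ⟨?_, ?_⟩
  · rw [hlam]
    have : 0 < 1 / (2 * (n₁ : ℝ)) := by positivity
    nlinarith
  · intro n hnn
    have hq : n / n₁ ≠ 0 := (Nat.div_pos hnn hn₁).ne'
    obtain ⟨k, hk⟩ : ∃ k, k = Nat.log 2 (n / n₁) := ⟨_, rfl⟩
    have hk1 : 2 ^ k * n₁ ≤ n := by
      rw [hk]
      exact (Nat.mul_le_mul_right _ (Nat.pow_log_le_self 2 hq)).trans (Nat.div_mul_le_self n n₁)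
    have hk2 : n < 2 ^ (k + 1) * n₁ := by
      rw [hk]
      exact (Nat.div_lt_iff_lt_mul hn₁).1 (Nat.lt_pow_succ_log_self (by norm_num) _)
    have hm : 1 ≤ 2 ^ k * n₁ := Nat.mul_pos (by positivity) hn₁
    have hr0 := hnonneg _ hm
    have hm' : (1 : ℝ) ≤ ((2 ^ k * n₁ : ℕ) : ℝ) := by exact_mod_cast hm
    have hmd : (1 : ℝ) ≤ ((2 ^ k * n₁ : ℕ) : ℝ) ^ d := one_le_pow₀ hm'
    have hS : 1 ≤ 2 ^ d * Chat * ((2 ^ k * n₁ : ℕ) : ℝ) ^ d :=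
      one_le_mul_of_one_le_of_one_le (one_le_mul_of_one_le_of_one_le h2d hC1) hmd
    have h3 : ρ n ≤ a ^ (2 ^ k) :=
      (hantitone _ _ hm hk1).trans ((le_mul_of_one_le_left hr0 hS).trans (hkey k))
    refine h3.trans ?_
    have h4 : a ^ (2 ^ k) = Real.exp ((2 ^ k : ℝ) * Real.log a) := by
      have := Real.exp_nat_mul (Real.log a) (2 ^ k)
      rw [Real.exp_log ha0] at this
      rw [← this]
      push_cast
      rfl
    rw [h4, Real.exp_le_exp, hlam]
    have h5 : (n : ℝ) / (2 * n₁) ≤ 2 ^ k := by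
      rw [div_le_iff₀ (by positivity)]
      have : (n : ℝ) ≤ 2 ^ (k + 1) * n₁ := by exact_mod_cast hk2.le
      rw [pow_succ] at this
      linarith
    have h6 : -(-(1 / (2 * (n₁ : ℝ))) * Real.log a) * n = (n : ℝ) / (2 * n₁) * Real.log a := by
      ring
    rw [h6]
    exact mul_le_mul_of_nonpos_right h5 hlog.le
end
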